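/- Let A be a normal fanning frame (so P_1 ≡ 0) with coefficient curves P_2,…,P_k, horizontal derivative H(t) and fundamental projection P(t). Then for every t ∈ ℝ: P'(t)·A^{(i)}(t) = 0 for all 0 ≤ i ≤ k−3; P'(t)·A^{(k−2)}(t) = H(t); and P'(t)·H(t) = Σ_{j=1}^{k−1} C(k−1,j)·A^{(k−1−j)}(t)·(P_{j+1}(t) − P_j'(t)) (where P_1 = 0). -/

import Mathlib

open Matrix

noncomputable def mderiv {M N : ℕ} (A : ℝ → Matrix (Fin M) (Fin N) ℝ) :
    ℝ → Matrix (Fin M) (Fin N) ℝ :=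
  fun t => Matrix.of fun i j => deriv (fun s => A s i j) t

noncomputable def dmat {M N : ℕ} (i : ℕ) (A : ℝ → Matrix (Fin M) (Fin N) ℝ) :
    ℝ → Matrix (Fin M) (Fin N) ℝ :=
  mderiv^[i] A

def MatSmooth {M N : ℕ} (A : ℝ → Matrix (Fin M) (Fin N) ℝ) : Prop :=
  ∀ i j, ContDiff ℝ (⊤ : ℕ∞) fun t => A t i j

def juxt (k n : ℕ) (B : Fin k → Matrix (Fin (k * n)) (Fin n) ℝ) :
    Matrix (Fin (k * n)) (Fin (k * n)) ℝ :=
  Matrix.of fun r c => B (finProdFinEquiv.symm c).1 r (finProdFinEquiv.symm c).2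

noncomputable def frameMat (k n : ℕ) (A : ℝ → Matrix (Fin (k * n)) (Fin n) ℝ) (t : ℝ) :
    Matrix (Fin (k * n)) (Fin (k * n)) ℝ :=
  juxt k n fun i => dmat (i : ℕ) A t

def IsFanning (k n : ℕ) (A : ℝ → Matrix (Fin (k * n)) (Fin n) ℝ) : Prop :=
  MatSmooth A ∧ ∀ t, IsUnit (frameMat k n A t)

def IsCoeffs (k n : ℕ) (A : ℝ → Matrix (Fin (k * n)) (Fin n) ℝ)
    (P : ℕ → ℝ → Matrix (Fin n) (Fin n) ℝ) : Prop :=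
  (∀ i ∈ Finset.Icc 1 k, MatSmooth (P i)) ∧
  ∀ t, dmat k A t + ∑ i ∈ Finset.Icc 1 k, (k.choose i : ℝ) • (dmat (k - i) A t * P i t) = 0

noncomputable def Nmat (k n : ℕ) : Matrix (Fin (k * n)) (Fin (k * n)) ℝ :=
  Matrix.of fun r c =>
    if ((finProdFinEquiv.symm c).1 : ℕ) = ((finProdFinEquiv.symm r).1 : ℕ) + 1 ∧
        (finProdFinEquiv.symm c).2 = (finProdFinEquiv.symm r).2 then
      (((finProdFinEquiv.symm r).1 : ℕ) + 1 : ℝ)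
    else 0

noncomputable def fundEnd (k n : ℕ) (A : ℝ → Matrix (Fin (k * n)) (Fin n) ℝ) (t : ℝ) :
    Matrix (Fin (k * n)) (Fin (k * n)) ℝ :=
  frameMat k n A t * Nmat k n * (frameMat k n A t)⁻¹

noncomputable def fundRefl (k n : ℕ) (A : ℝ → Matrix (Fin (k * n)) (Fin n) ℝ) (t : ℝ) :
    Matrix (Fin (k * n)) (Fin (k * n)) ℝ :=
  (k : ℝ)⁻¹ • ((2 : ℝ) • mderiv (fundEnd k n A) t - ((k : ℝ) - 2) • (1 : Matrix (Fin (k * n)) (Fin (k * n)) ℝ))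

noncomputable def fundProj (k n : ℕ) (A : ℝ → Matrix (Fin (k * n)) (Fin n) ℝ) (t : ℝ) :
    Matrix (Fin (k * n)) (Fin (k * n)) ℝ :=
  (2 : ℝ)⁻¹ • ((1 : Matrix (Fin (k * n)) (Fin (k * n)) ℝ) - fundRefl k n A t)

noncomputable def horDer (k n : ℕ) (A : ℝ → Matrix (Fin (k * n)) (Fin n) ℝ)
    (P : ℕ → ℝ → Matrix (Fin n) (Fin n) ℝ) (t : ℝ) : Matrix (Fin (k * n)) (Fin n) ℝ :=
  dmat (k - 1) A t + ∑ i ∈ Finset.Icc 1 (k - 1), ((k - 1).choose i : ℝ) • (dmat (k - 1 - i) A t * P i t)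

noncomputable def jacobiEnd (k n : ℕ) (A : ℝ → Matrix (Fin (k * n)) (Fin n) ℝ) (t : ℝ) :
    Matrix (Fin (k * n)) (Fin (k * n)) ℝ :=
  (((k : ℝ)) ^ 2)⁻¹ • (mderiv (mderiv (fundEnd k n A)) t * mderiv (mderiv (fundEnd k n A)) t)

section MatrixCurves

variable {L M N : ℕ}

theorem MatSmooth.hasDerivAt {X : ℝ → Matrix (Fin M) (Fin N) ℝ} (hX : MatSmooth X)
    (i : Fin M) (j : Fin N) (t : ℝ) : HasDerivAt (fun s => X s i j) (mderiv X t i j) t :=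
  ((hX i j).differentiable (by simp) t).hasDerivAt

theorem MatSmooth.mderiv {X : ℝ → Matrix (Fin M) (Fin N) ℝ} (hX : MatSmooth X) :
    MatSmooth (mderiv X) := fun i j => (contDiff_infty_iff_deriv.1 (hX i j)).2

theorem dmat_succ (i : ℕ) (X : ℝ → Matrix (Fin M) (Fin N) ℝ) :
    dmat (i + 1) X = mderiv (dmat i X) :=
  Function.iterate_succ_apply' _ _ _

theorem MatSmooth.dmat {X : ℝ → Matrix (Fin M) (Fin N) ℝ} (hX : MatSmooth X) (i : ℕ) :
    MatSmooth (dmat i X) := by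
  induction i with
  | zero => exact hX
  | succ i ih => rw [dmat_succ]; exact ih.mderiv

theorem matSmooth_const (B : Matrix (Fin M) (Fin N) ℝ) : MatSmooth fun _ => B :=
  fun _ _ => contDiff_const

theorem MatSmooth.add {X Y : ℝ → Matrix (Fin M) (Fin N) ℝ} (hX : MatSmooth X)
    (hY : MatSmooth Y) : MatSmooth fun t => X t + Y t :=
  fun i j => (hX i j).add (hY i j)

theorem MatSmooth.sub {X Y : ℝ → Matrix (Fin M) (Fin N) ℝ} (hX : MatSmooth X)
    (hY : MatSmooth Y) : MatSmooth fun t => X t - Y t :=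
  fun i j => (hX i j).sub (hY i j)

theorem MatSmooth.const_smul {X : ℝ → Matrix (Fin M) (Fin N) ℝ} (c : ℝ) (hX : MatSmooth X) :
    MatSmooth fun t => c • X t :=
  fun i j => contDiff_const.mul (hX i j)

theorem MatSmooth.mul {X : ℝ → Matrix (Fin L) (Fin M) ℝ} {Y : ℝ → Matrix (Fin M) (Fin N) ℝ}
    (hX : MatSmooth X) (hY : MatSmooth Y) : MatSmooth fun t => X t * Y t := by
  intro i j
  simp only [Matrix.mul_apply]
  exact ContDiff.sum fun l _ => (hX i l).mul (hY l j)

theorem MatSmooth.sum {ι : Type*} {s : Finset ι} {X : ι → ℝ → Matrix (Fin M) (Fin N) ℝ}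
    (hX : ∀ l ∈ s, MatSmooth (X l)) : MatSmooth fun t => ∑ l ∈ s, X l t := by
  intro i j
  simp only [Matrix.sum_apply]
  exact ContDiff.sum fun l hl => hX l hl i j

theorem MatSmooth.det {X : ℝ → Matrix (Fin M) (Fin M) ℝ} (hX : MatSmooth X) :
    ContDiff ℝ (⊤ : ℕ∞) fun t => (X t).det := by
  simp only [Matrix.det_apply']
  exact ContDiff.sum fun σ _ => contDiff_const.mul (contDiff_prod fun i _ => hX (σ i) i)

theorem MatSmooth.adjugate {X : ℝ → Matrix (Fin M) (Fin M) ℝ} (hX : MatSmooth X) :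
    MatSmooth fun t => (X t).adjugate := by
  intro i j
  simp only [Matrix.adjugate_apply]
  refine MatSmooth.det fun a b => ?_
  simp only [Matrix.updateRow_apply]
  split_ifs
  · exact contDiff_const
  · exact hX a b

theorem MatSmooth.inv {X : ℝ → Matrix (Fin M) (Fin M) ℝ} (hX : MatSmooth X)
    (hu : ∀ t, IsUnit (X t)) : MatSmooth fun t => (X t)⁻¹ := by
  intro i j
  have h : ∀ t, (X t).det ≠ 0 := fun t => ((Matrix.isUnit_iff_isUnit_det _).1 (hu t)).ne_zero
  simp only [Matrix.inv_def, Ring.inverse_eq_inv', Matrix.smul_apply, smul_eq_mul]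
  exact (hX.det.inv h).mul (hX.adjugate i j)

theorem mderiv_const (B : Matrix (Fin M) (Fin N) ℝ) (t : ℝ) : mderiv (fun _ => B) t = 0 := by
  ext i j
  simp [mderiv]

theorem mderiv_add {X Y : ℝ → Matrix (Fin M) (Fin N) ℝ} (hX : MatSmooth X) (hY : MatSmooth Y)
    (t : ℝ) : mderiv (fun s => X s + Y s) t = mderiv X t + mderiv Y t := by
  ext i j
  exact ((hX.hasDerivAt i j t).add (hY.hasDerivAt i j t)).deriv

theorem mderiv_const_smul {X : ℝ → Matrix (Fin M) (Fin N) ℝ} (c : ℝ) (hX : MatSmooth X)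
    (t : ℝ) : mderiv (fun s => c • X s) t = c • mderiv X t := by
  ext i j
  exact ((hX.hasDerivAt i j t).const_mul c).deriv

theorem mderiv_mul {X : ℝ → Matrix (Fin L) (Fin M) ℝ} {Y : ℝ → Matrix (Fin M) (Fin N) ℝ}
    (hX : MatSmooth X) (hY : MatSmooth Y) (t : ℝ) :
    mderiv (fun s => X s * Y s) t = mderiv X t * Y t + X t * mderiv Y t := by
  ext i j
  have h := HasDerivAt.fun_sum (u := Finset.univ) fun l _ =>
    (hX.hasDerivAt i l t).mul (hY.hasDerivAt l j t)
  simp only [Matrix.add_apply, Matrix.mul_apply, ← Finset.sum_add_distrib]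
  rw [← h.deriv]
  simp [mderiv, Matrix.mul_apply]

theorem mderiv_sum {ι : Type*} {s : Finset ι} {X : ι → ℝ → Matrix (Fin M) (Fin N) ℝ}
    (hX : ∀ l ∈ s, MatSmooth (X l)) (t : ℝ) :
    mderiv (fun u => ∑ l ∈ s, X l u) t = ∑ l ∈ s, mderiv (X l) t := by
  ext i j
  have h := HasDerivAt.fun_sum (u := s) fun l hl => (hX l hl).hasDerivAt i j t
  rw [Matrix.sum_apply, ← h.deriv]
  simp [mderiv, Matrix.sum_apply]

end MatrixCurves

section Frames

variable {k n : ℕ}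

theorem mul_juxt (X : Matrix (Fin (k * n)) (Fin (k * n)) ℝ)
    (B : Fin k → Matrix (Fin (k * n)) (Fin n) ℝ) :
    X * juxt k n B = juxt k n fun i => X * B i := by
  ext r c
  simp [juxt, Matrix.mul_apply]

theorem juxt_injective : Function.Injective (juxt k n) := by
  intro B C h
  funext i
  ext r j
  simpa only [juxt, Matrix.of_apply, Equiv.symm_apply_apply] using
    congrFun (congrFun h r) (finProdFinEquiv (i, j))

theorem juxt_mul_Nmat (a : ℕ → Matrix (Fin (k * n)) (Fin n) ℝ) :
    juxt k n (fun i => a i) * Nmat k n = juxt k n fun i => ((i : ℕ) : ℝ) • a (i - 1) := by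
  ext r c
  obtain ⟨⟨i, j⟩, rfl⟩ := finProdFinEquiv.surjective c
  rw [Matrix.mul_apply, ← finProdFinEquiv.sum_comp, Fintype.sum_prod_type]
  simp only [juxt, Nmat, Matrix.of_apply, Equiv.symm_apply_apply, Matrix.smul_apply, smul_eq_mul]
  obtain ⟨_ | i, hi⟩ := i
  · simp
  · rw [Finset.sum_eq_single ⟨i, by omega⟩, Finset.sum_eq_single j]
    · simp [mul_comm]
    · intro b _ hb
      simp [hb.symm]
    · simp
    · intro b _ hb
      refine Finset.sum_eq_zero fun x _ => ?_
      rw [if_neg, mul_zero]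
      rintro ⟨h, -⟩
      exact hb (Fin.ext (by simpa using h.symm))
    · simp

variable {A : ℝ → Matrix (Fin (k * n)) (Fin n) ℝ} {P : ℕ → ℝ → Matrix (Fin n) (Fin n) ℝ}

theorem IsFanning.matSmooth_fundEnd (hA : IsFanning k n A) : MatSmooth (fundEnd k n A) := by
  have h : MatSmooth (frameMat k n A) := fun r c => hA.1.dmat _ r _
  exact (h.mul (matSmooth_const _)).mul (h.inv hA.2)

theorem IsFanning.fundEnd_mul_dmat (hA : IsFanning k n A) {i : ℕ} (hi : i < k) (t : ℝ) :
    fundEnd k n A t * dmat i A t = (i : ℝ) • dmat (i - 1) A t := by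
  have h : fundEnd k n A t * frameMat k n A t = frameMat k n A t * Nmat k n := by
    rw [fundEnd, Matrix.nonsing_inv_mul_cancel_right _ _
      ((Matrix.isUnit_iff_isUnit_det _).1 (hA.2 t))]
  rw [frameMat, mul_juxt, juxt_mul_Nmat fun i => dmat i A t] at h
  exact congrFun (juxt_injective h) ⟨i, hi⟩

theorem IsFanning.mderiv_fundEnd_mul_dmat (hA : IsFanning k n A) {i : ℕ} (hi : i < k) (t : ℝ) :
    mderiv (fundEnd k n A) t * dmat i A t =
      (i : ℝ) • dmat i A t - fundEnd k n A t * dmat (i + 1) A t := by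
  have h := mderiv_mul hA.matSmooth_fundEnd (hA.1.dmat i) t
  rw [funext fun s => hA.fundEnd_mul_dmat hi s, mderiv_const_smul _ (hA.1.dmat _),
    ← dmat_succ, ← dmat_succ] at h
  rw [eq_sub_iff_add_eq, ← h]
  cases i <;> simp

theorem fundProj_eq (hk : k ≠ 0) (t : ℝ) : fundProj k n A t =
    (k : ℝ)⁻¹ • (((k : ℝ) - 1) • (1 : Matrix (Fin (k * n)) (Fin (k * n)) ℝ)
      - mderiv (fundEnd k n A) t) := by
  have hk' : (k : ℝ) ≠ 0 := by exact_mod_cast hk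
  rw [fundProj, fundRefl]
  match_scalars
  · field_simp
    ring
  · field_simp

theorem IsFanning.matSmooth_fundProj (hA : IsFanning k n A) (hk : k ≠ 0) :
    MatSmooth (fundProj k n A) := by
  rw [funext (fundProj_eq (A := A) hk)]
  exact .const_smul _ ((matSmooth_const _).sub hA.matSmooth_fundEnd.mderiv)

theorem IsFanning.fundProj_mul_dmat (hA : IsFanning k n A) {i : ℕ} (hi : i + 1 < k) (t : ℝ) :
    fundProj k n A t * dmat i A t = dmat i A t := by
  have hk' : (k : ℝ) ≠ 0 := by norm_cast; omega
  rw [fundProj_eq (by omega), Matrix.smul_mul, Matrix.sub_mul, Matrix.smul_mul, Matrix.one_mul,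
    hA.mderiv_fundEnd_mul_dmat (by omega), hA.fundEnd_mul_dmat hi, Nat.add_sub_cancel]
  match_scalars
  field_simp
  ring

theorem IsCoeffs.matSmooth_horDer (hP : IsCoeffs k n A P) (hA : MatSmooth A) :
    MatSmooth (horDer k n A P) :=
  (hA.dmat _).add <| .sum fun i hi => .const_smul _ <|
    (hA.dmat _).mul (hP.1 i (by simp only [Finset.mem_Icc] at hi ⊢; omega))

theorem IsCoeffs.fundEnd_mul_dmat_self (hP : IsCoeffs k n A P) (hA : IsFanning k n A)
    (hk : k ≠ 0) (t : ℝ) : fundEnd k n A t * dmat k A t =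
      (k : ℝ) • (dmat (k - 1) A t - horDer k n A P t) := by
  obtain ⟨m, rfl⟩ := Nat.exists_eq_add_one_of_ne_zero hk
  rw [eq_neg_of_add_eq_zero_left (hP.2 t), horDer, Matrix.mul_neg, Matrix.mul_sum,
    Finset.sum_Icc_succ_top (by omega), Nat.add_sub_cancel, sub_add_cancel_left,
    smul_neg, Finset.smul_sum, Nat.sub_self, Matrix.mul_smul, ← Matrix.mul_assoc,
    hA.fundEnd_mul_dmat (by omega)]
  simp only [Nat.cast_zero, zero_smul, Matrix.zero_mul, smul_zero, add_zero]
  refine congrArg _ (Finset.sum_congr rfl fun i hi => ?_)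
  rw [Finset.mem_Icc] at hi
  have hc : ((m + 1).choose i : ℝ) * ((m + 1 - i : ℕ) : ℝ) =
      ((m + 1 : ℕ) : ℝ) * (m.choose i : ℝ) := by
    rw [mul_comm _ (m.choose i : ℝ)]
    exact_mod_cast (Nat.choose_mul_succ_eq m i).symm
  rw [Matrix.mul_smul, ← Matrix.mul_assoc, hA.fundEnd_mul_dmat (by omega), Matrix.smul_mul,
    smul_smul, smul_smul, hc, show m + 1 - i - 1 = m - i by omega]

theorem IsCoeffs.fundProj_mul_dmat_pred (hP : IsCoeffs k n A P) (hA : IsFanning k n A)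
    (hk : k ≠ 0) (t : ℝ) : fundProj k n A t * dmat (k - 1) A t =
      dmat (k - 1) A t - horDer k n A P t := by
  have hk' : (k : ℝ) ≠ 0 := by exact_mod_cast hk
  rw [fundProj_eq hk, Matrix.smul_mul, Matrix.sub_mul, Matrix.smul_mul, Matrix.one_mul,
    hA.mderiv_fundEnd_mul_dmat (by omega), Nat.sub_add_cancel (by omega),
    hP.fundEnd_mul_dmat_self hA hk, Nat.cast_pred (by omega)]
  match_scalars
  · field_simp
    ring
  · field_simp

theorem IsFanning.fundProj_mul_sum (hA : IsFanning k n A) (c : ℕ → ℝ)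
    (Q : ℕ → Matrix (Fin n) (Fin n) ℝ) (t : ℝ) :
    fundProj k n A t * ∑ j ∈ Finset.Icc 1 (k - 1), c j • (dmat (k - 1 - j) A t * Q j) =
      ∑ j ∈ Finset.Icc 1 (k - 1), c j • (dmat (k - 1 - j) A t * Q j) := by
  rw [Matrix.mul_sum]
  refine Finset.sum_congr rfl fun j hj => ?_
  rw [Finset.mem_Icc] at hj
  rw [Matrix.mul_smul, ← Matrix.mul_assoc, hA.fundProj_mul_dmat (by omega)]

theorem IsCoeffs.fundProj_mul_horDer (hP : IsCoeffs k n A P) (hA : IsFanning k n A)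
    (hk : k ≠ 0) (t : ℝ) : fundProj k n A t * horDer k n A P t = 0 := by
  conv_lhs => rw [horDer]
  rw [Matrix.mul_add, hP.fundProj_mul_dmat_pred hA hk, hA.fundProj_mul_sum, horDer]
  abel

theorem IsCoeffs.mderiv_horDer (hP : IsCoeffs k n A P) (hA : MatSmooth A) (hk : k ≠ 0)
    (t : ℝ) : mderiv (horDer k n A P) t = -(dmat (k - 1) A t * P 1 t) -
      ∑ j ∈ Finset.Icc 1 (k - 1), ((k - 1).choose j : ℝ) •
        (dmat (k - 1 - j) A t * (P (j + 1) t - mderiv (P j) t)) := by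
  have hS : ∀ i ∈ Finset.Icc 1 (k - 1), MatSmooth (P i) := fun i hi =>
    hP.1 i (by simp only [Finset.mem_Icc] at hi ⊢; omega)
  obtain ⟨m, rfl⟩ := Nat.exists_eq_add_one_of_ne_zero hk
  have hR := hP.2 t
  simp only [Nat.add_sub_cancel] at hS hR ⊢
  have h1 : mderiv (horDer (m + 1) n A P) t = dmat (m + 1) A t +
      ∑ i ∈ Finset.Icc 1 m, (m.choose i : ℝ) •
        (dmat (m + 1 - i) A t * P i t + dmat (m - i) A t * mderiv (P i) t) := by
    rw [show horDer (m + 1) n A P = fun t => dmat m A t + ∑ i ∈ Finset.Icc 1 m,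
      (m.choose i : ℝ) • (dmat (m - i) A t * P i t) from rfl,
      mderiv_add (hA.dmat m) (.sum fun i hi => .const_smul _ ((hA.dmat _).mul (hS i hi))),
      mderiv_sum fun i hi => .const_smul _ ((hA.dmat _).mul (hS i hi)), dmat_succ]
    refine congrArg _ (Finset.sum_congr rfl fun i hi => ?_)
    rw [mderiv_const_smul _ ((hA.dmat _).mul (hS i hi)), mderiv_mul (hA.dmat _) (hS i hi),
      ← dmat_succ]
    rw [Finset.mem_Icc] at hi
    rw [show m - i + 1 = m + 1 - i by omega]
  have h2 : ∑ i ∈ Finset.Icc 1 (m + 1), ((m + 1).choose i : ℝ) • (dmat (m + 1 - i) A t * P i t) =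
      ∑ i ∈ Finset.Icc 1 m, (m.choose i : ℝ) • (dmat (m + 1 - i) A t * P i t) +
      (dmat m A t * P 1 t +
        ∑ j ∈ Finset.Icc 1 m, (m.choose j : ℝ) • (dmat (m - j) A t * P (j + 1) t)) := by
    have e : ∀ (l : ℕ) (f : ℕ → Matrix (Fin ((m + 1) * n)) (Fin n) ℝ),
        ∑ i ∈ Finset.Icc 1 l, f i = ∑ i ∈ Finset.range l, f (i + 1) := fun l f => by
      rw [Finset.range_eq_Ico, Finset.sum_Ico_add' f 0 l 1]
      rfl
    have hpas : ∀ i, ((m + 1).choose (i + 1) : ℝ) = m.choose i + m.choose (i + 1) := fun i => by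
      exact_mod_cast Nat.choose_succ_succ m i
    simp only [e, hpas, add_smul, Finset.sum_add_distrib, Nat.add_sub_add_right]
    rw [Finset.sum_range_succ' fun i => (m.choose i : ℝ) • (dmat (m - i) A t * P (i + 1) t),
      Finset.sum_range_succ fun i => (m.choose (i + 1) : ℝ) • (dmat (m - i) A t * P (i + 1) t)]
    simp
    abel
  rw [h1, eq_neg_of_add_eq_zero_left hR, h2]
  simp only [Matrix.mul_sub, smul_sub, smul_add, Finset.sum_add_distrib, Finset.sum_sub_distrib]
  abel

theorem IsFanning.mderiv_fundProj_mul_dmat (hA : IsFanning k n A) {i : ℕ} (hi : i + 1 < k)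
    (t : ℝ) : mderiv (fundProj k n A) t * dmat i A t =
      dmat (i + 1) A t - fundProj k n A t * dmat (i + 1) A t := by
  have h := mderiv_mul (hA.matSmooth_fundProj (by omega)) (hA.1.dmat i) t
  rw [funext fun s => hA.fundProj_mul_dmat hi s, ← dmat_succ] at h
  exact eq_sub_of_add_eq h.symm

end Frames

/-- The matrix of `P'(t)` for a normal frame in the basis
`(A | A' | … | A^{(k-2)} | H)`: `P'` kills `A, …, A^{(k-3)}`, `P' A^{(k-2)} = H`, and
`P' H = ∑_{j=1}^{k-1} C(k-1,j) A^{(k-1-j)} (P_{j+1} - P_j')`. -/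
theorem stmt_12 (k n : ℕ) (hk : 2 ≤ k) (hn : 1 ≤ n)
    (A : ℝ → Matrix (Fin (k * n)) (Fin n) ℝ) (hA : IsFanning k n A)
    (P : ℕ → ℝ → Matrix (Fin n) (Fin n) ℝ) (hP : IsCoeffs k n A P)
    (hP1 : ∀ t, P 1 t = 0) (t : ℝ) :
    (∀ i : ℕ, i + 3 ≤ k → mderiv (fundProj k n A) t * dmat i A t = 0) ∧
    mderiv (fundProj k n A) t * dmat (k - 2) A t = horDer k n A P t ∧
    mderiv (fundProj k n A) t * horDer k n A P t =
      ∑ j ∈ Finset.Icc 1 (k - 1), ((k - 1).choose j : ℝ) •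
        (dmat (k - 1 - j) A t * (P (j + 1) t - mderiv (P j) t)) := by
  refine ⟨fun i hi => ?_, ?_, ?_⟩
  · rw [hA.mderiv_fundProj_mul_dmat (by omega), hA.fundProj_mul_dmat (by omega), sub_self]
  · rw [hA.mderiv_fundProj_mul_dmat (by omega), show k - 2 + 1 = k - 1 by omega,
      hP.fundProj_mul_dmat_pred hA (by omega), sub_sub_cancel]
  · have h := mderiv_mul (hA.matSmooth_fundProj (by omega)) (hP.matSmooth_horDer hA.1) t
    rw [funext fun s => hP.fundProj_mul_horDer hA (by omega) s, mderiv_const,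
      hP.mderiv_horDer hA.1 (by omega), hP1, Matrix.mul_zero, neg_zero, zero_sub, Matrix.mul_neg,
      hA.fundProj_mul_sum (fun j => ((k - 1).choose j : ℝ))] at h
    exact (add_neg_eq_zero.1 h.symm)
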